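/- arXiv:1209.2353 — 2 statements merged into one kernel-verified Lean document; each statement's English description precedes it below -/
import Mathlib

section
/- The number of permutations of {1,...,n} containing exactly one occurrence of the pattern [1,2,3] equals (3/n)·C(2n, n−3) = 6·(2n−1)!/((n−3)!·(n+3)!). -/
open Finset

/-- Number of occurrences of the increasing pattern [1,2,3] in `π`. -/
def N3 {n : ℕ} (π : Equiv.Perm (Fin n)) : ℕ :=
  (Finset.univ.filter fun t : Fin n × Fin n × Fin n =>
    t.1 < t.2.1 ∧ t.2.1 < t.2.2 ∧ π t.1 < π t.2.1 ∧ π t.2.1 < π t.2.2).card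

/-- The permutation starting with `v` whose remaining entries are order isomorphic to `τ`. -/
def ins {s : ℕ} (v : Fin (s + 1)) (τ : Equiv.Perm (Fin s)) : Equiv.Perm (Fin (s + 1)) :=
  (finSuccEquiv' 0).trans ((Equiv.optionCongr τ).trans (finSuccEquiv' v).symm)

lemma ins_zero {s : ℕ} (v : Fin (s + 1)) (τ : Equiv.Perm (Fin s)) : ins v τ 0 = v := by
  simp [ins]

lemma ins_succ {s : ℕ} (v : Fin (s + 1)) (τ : Equiv.Perm (Fin s)) (i : Fin s) :
    ins v τ i.succ = v.succAbove (τ i) := by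
  have : finSuccEquiv' (0 : Fin (s + 1)) i.succ = some i := by
    rw [← Fin.zero_succAbove, finSuccEquiv'_succAbove]
  simp [ins, this]

lemma ins_bij (s : ℕ) :
    Function.Bijective (fun p : Fin (s + 1) × Equiv.Perm (Fin s) => ins p.1 p.2) := by
  rw [Fintype.bijective_iff_injective_and_card]
  constructor
  · rintro ⟨v, τ⟩ ⟨w, ρ⟩ h
    simp only at h
    have h0 : v = w := by rw [← ins_zero v τ, h, ins_zero]
    subst h0
    have : τ = ρ := by
      ext i
      have := ins_succ v τ i
      rw [h, ins_succ] at this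
      rw [Fin.succAbove_right_injective this]
    rw [this]
  · simp [Fintype.card_perm, Nat.factorial_succ]

lemma sum_ins (s : ℕ) (f : Equiv.Perm (Fin (s + 1)) → ℕ) :
    ∑ σ, f σ = ∑ v : Fin (s + 1), ∑ τ : Equiv.Perm (Fin s), f (ins v τ) := by
  rw [← Fintype.sum_prod_type']
  exact ((ins_bij s).sum_comp f).symm

/-- Number of ascending pairs with all values at least `a`. -/
def Asc {s : ℕ} (a : ℕ) (σ : Equiv.Perm (Fin s)) : ℕ :=
  ∑ i : Fin s, ∑ j : Fin s, if i < j ∧ a ≤ (σ i : ℕ) ∧ σ i < σ j then 1 else 0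

lemma N3_eq {n : ℕ} (π : Equiv.Perm (Fin n)) : N3 π = ∑ i : Fin n, ∑ j : Fin n, ∑ k : Fin n,
    if i < j ∧ j < k ∧ π i < π j ∧ π j < π k then 1 else 0 := by
  rw [N3, card_filter, Fintype.sum_prod_type]
  simp_rw [Fintype.sum_prod_type]

lemma lt_succAbove_val {s : ℕ} (v : Fin (s + 1)) (x : Fin s) :
    v < v.succAbove x ↔ (v : ℕ) ≤ (x : ℕ) := by
  rw [Fin.lt_succAbove_iff_le_castSucc, Fin.le_def]; simp

lemma le_succAbove_val {s : ℕ} (a : ℕ) (v : Fin (s + 1)) (x : Fin s) :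
    a ≤ (v.succAbove x : ℕ) ↔ (if a ≤ (v : ℕ) then a else a - 1) ≤ (x : ℕ) := by
  rw [Fin.succAbove]
  simp only [Fin.lt_def]
  split_ifs <;> simp at * <;> omega

lemma N3_ins {s : ℕ} (v : Fin (s + 1)) (τ : Equiv.Perm (Fin s)) :
    N3 (ins v τ) = Asc v τ + N3 τ := by
  rw [N3_eq, N3_eq, Fin.sum_univ_succ]
  congr 1
  · rw [Fin.sum_univ_succ, Asc]
    simp only [Fin.sum_univ_succ (n := s), ins_zero, ins_succ]
    simp [lt_succAbove_val]
  · simp only [Fin.sum_univ_succ (n := s), ins_zero, ins_succ]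
    simp

lemma card_ge {s : ℕ} (v : ℕ) (τ : Equiv.Perm (Fin s)) :
    (∑ j : Fin s, if v ≤ (τ j : ℕ) then 1 else 0) = s - v := by
  rw [Equiv.sum_comp τ (fun j : Fin s => if v ≤ (j : ℕ) then 1 else 0)]
  rw [Fin.sum_univ_eq_sum_range (fun j => if v ≤ j then 1 else 0), ← card_filter]
  have : (range s).filter (fun j => v ≤ j) = Ico v s := by ext; simp; omega
  rw [this, Nat.card_Ico]

lemma Asc_ins {s : ℕ} (a : ℕ) (v : Fin (s + 1)) (τ : Equiv.Perm (Fin s)) :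
    Asc a (ins v τ) = if a ≤ (v : ℕ) then (s - v) + Asc a τ else Asc (a - 1) τ := by
  rw [Asc, Fin.sum_univ_succ]
  simp only [Fin.sum_univ_succ (n := s), ins_zero, ins_succ, le_succAbove_val, lt_succAbove_val]
  by_cases h : a ≤ (v : ℕ)
  · have hc := card_ge v τ
    rw [← card_filter] at hc
    simp [h, Asc, hc]
  · simp [h, Asc]

lemma Asc_anti {s : ℕ} {a b : ℕ} (h : a ≤ b) (σ : Equiv.Perm (Fin s)) : Asc b σ ≤ Asc a σ := by
  unfold Asc
  gcongr with i _ j _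
  split_ifs with h1 h2 <;> first | omega | exact absurd ⟨h1.1, h.trans h1.2.1, h1.2.2⟩ h2

lemma Asc_zero {s : ℕ} {a : ℕ} (h : s ≤ a + 1) (σ : Equiv.Perm (Fin s)) : Asc a σ = 0 := by
  unfold Asc
  refine sum_eq_zero fun i _ => sum_eq_zero fun j _ => if_neg ?_
  rintro ⟨_, h2, h3⟩
  have := (σ j).2
  rw [Fin.lt_def] at h3
  omega

/-- Avoiders with no ascending pair at level `a` and above. -/
def MM (s a : ℕ) : ℕ := ∑ τ : Equiv.Perm (Fin s), if N3 τ = 0 ∧ Asc a τ = 0 then 1 else 0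

/-- Permutations with one occurrence, counting pairs above `a`, and no pair above `b`. -/
def YY (s a b : ℕ) : ℕ :=
  ∑ τ : Equiv.Perm (Fin s), if N3 τ + Asc a τ = 1 ∧ Asc b τ = 0 then 1 else 0

lemma MM_rec (s a : ℕ) :
    MM (s + 1) a = ∑ v ∈ range (s + 1),
      if v < a then MM s v else if v = s then MM s a else 0 := by
  rw [MM, sum_ins, ← Fin.sum_univ_eq_sum_range
    (fun v => if v < a then MM s v else if v = s then MM s a else 0)]
  refine sum_congr rfl fun v _ => ?_
  have hv := v.2
  by_cases h : (v : ℕ) < a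
  · rw [if_pos h, MM]
    refine sum_congr rfl fun τ _ => if_congr ?_ rfl rfl
    have h1 := Asc_anti (show (v : ℕ) ≤ a - 1 by omega) τ
    rw [N3_ins, Asc_ins, if_neg (by omega)]
    omega
  · rw [if_neg h]
    by_cases h2 : (v : ℕ) = s
    · rw [if_pos h2, MM]
      refine sum_congr rfl fun τ _ => if_congr ?_ rfl rfl
      have h1 := Asc_zero (show s ≤ (v : ℕ) + 1 by omega) τ
      rw [N3_ins, Asc_ins, if_pos (by omega)]
      omega
    · rw [if_neg h2]
      refine sum_eq_zero fun τ _ => if_neg ?_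
      rw [N3_ins, Asc_ins, if_pos (by omega)]
      omega

lemma YY_rec (s a b : ℕ) (hab : a ≤ b) :
    YY (s + 1) a b = ∑ v ∈ range (s + 1),
      ((if v < a then YY s v (a - 1) else 0) + (if v = s then if a ≤ s then YY s a b else 0 else 0)
        + (if v + 1 = s then if a < s ∧ s ≤ b then MM s a else 0 else 0)) := by
  rw [YY, sum_ins, ← Fin.sum_univ_eq_sum_range
    (fun v => ((if v < a then YY s v (a - 1) else 0) +
        (if v = s then if a ≤ s then YY s a b else 0 else 0)
        + (if v + 1 = s then if a < s ∧ s ≤ b then MM s a else 0 else 0)))]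
  refine sum_congr rfl fun v _ => ?_
  have hv := v.2
  by_cases h : (v : ℕ) < a
  · have e1 : (if (v : ℕ) = s then if a ≤ s then YY s a b else 0 else 0) = 0 := by
      split_ifs <;> first | rfl | omega
    have e2 : (if (v : ℕ) + 1 = s then if a < s ∧ s ≤ b then MM s a else 0 else 0) = 0 := by
      split_ifs <;> first | rfl | omega
    rw [if_pos h, e1, e2, YY]
    refine sum_congr rfl fun τ _ => if_congr ?_ rfl rfl
    have h1 := Asc_anti (show (v : ℕ) ≤ a - 1 by omega) τ
    have h2 := Asc_anti (show a - 1 ≤ b - 1 by omega) τ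
    rw [N3_ins, Asc_ins, Asc_ins, if_neg (by omega), if_neg (by omega)]
    omega
  · rw [if_neg h]
    by_cases h2 : (v : ℕ) = s
    · rw [if_pos h2, if_pos (by omega), if_neg (by omega), YY, zero_add, add_zero]
      refine sum_congr rfl fun τ _ => if_congr ?_ rfl rfl
      have h1 := Asc_zero (show s ≤ (v : ℕ) + 1 by omega) τ
      rw [N3_ins, Asc_ins, Asc_ins, if_pos (by omega)]
      split_ifs with h3
      · omega
      · have h4 := Asc_zero (show s ≤ b + 1 by omega) τ
        have h5 := Asc_zero (show s ≤ b - 1 + 1 by omega) τ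
        omega
    · rw [if_neg h2]
      by_cases h3 : (v : ℕ) + 1 = s ∧ s ≤ b
      · rw [if_pos h3.1, if_pos (by omega), MM, zero_add, zero_add]
        refine sum_congr rfl fun τ _ => if_congr ?_ rfl rfl
        have h1 := Asc_zero (show s ≤ (v : ℕ) + 1 by omega) τ
        have h5 := Asc_zero (show s ≤ b - 1 + 1 by omega) τ
        rw [N3_ins, Asc_ins, Asc_ins, if_pos (by omega), if_neg (by omega)]
        omega
      · have e2 : (if (v : ℕ) + 1 = s then if a < s ∧ s ≤ b then MM s a else 0 else 0) = 0 := by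
          split_ifs <;> first | rfl | omega
        rw [e2]
        refine sum_eq_zero fun τ _ => if_neg ?_
        rw [N3_ins, Asc_ins, Asc_ins, if_pos (by omega)]
        split_ifs <;> omega

lemma MM_le (s a : ℕ) (h : a ≤ s) : MM (s + 1) a = ∑ v ∈ range (a + 1), MM s v := by
  rw [MM_rec, sum_range_succ, sum_range_succ _ a, if_neg (by omega), if_pos rfl]
  congr 1
  rw [← sum_range_add_sum_Ico _ h]
  rw [sum_congr rfl (g := fun v => MM s v)]
  · rw [sum_eq_zero (s := Ico a s), add_zero]
    intro x hx
    rw [mem_Ico] at hx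
    rw [if_neg (by omega), if_neg (by omega)]
  · intro x hx
    rw [mem_range] at hx
    rw [if_pos hx]

lemma MM_top (s : ℕ) : MM (s + 1) (s + 1) = ∑ v ∈ range (s + 1), MM s v := by
  rw [MM_rec]
  refine sum_congr rfl fun x hx => ?_
  rw [mem_range] at hx
  rw [if_pos hx]

/-- Summed version of `YY`. -/
def ZZ (s b : ℕ) : ℕ := ∑ a ∈ range (b + 1), YY s a b

lemma YY_rec' (s a b : ℕ) (hab : a ≤ b) (ha : a ≤ s + 1) :
    YY (s + 1) a b = ∑ v ∈ range a, YY s v (a - 1) + (if a ≤ s then YY s a b else 0)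
        + (if a < s ∧ s ≤ b then MM s a else 0) := by
  rw [YY_rec s a b hab, sum_add_distrib, sum_add_distrib]
  congr 1
  · congr 1
    · rw [← sum_range_add_sum_Ico _ ha]
      rw [sum_congr rfl (g := fun v => YY s v (a - 1))]
      · rw [sum_eq_zero (s := Ico a (s + 1)), add_zero]
        intro x hx
        rw [mem_Ico] at hx
        rw [if_neg (by omega)]
      · intro x hx
        rw [mem_range] at hx
        rw [if_pos hx]
    · rw [sum_ite_eq' (range (s + 1)) s]
      simp
  · rcases s with _ | s
    · simp
    · simp only [Nat.add_right_cancel_iff]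
      rw [sum_ite_eq' (range (s + 1 + 1)) s]
      simp

lemma ZZ_low (s b : ℕ) (h : b ≤ s) : ZZ (s + 1) b =
    ∑ a ∈ range b, ZZ s a + ZZ s b + if b = s then ∑ a ∈ range s, MM s a else 0 := by
  have e : ZZ (s + 1) b = ∑ a ∈ range (b + 1), (∑ v ∈ range a, YY s v (a - 1) + YY s a b
        + (if a < s ∧ s ≤ b then MM s a else 0)) := by
    refine sum_congr rfl fun a ha => ?_
    rw [mem_range] at ha
    rw [YY_rec' s a b (by omega) (by omega), if_pos (show a ≤ s by omega)]
  rw [e, sum_add_distrib, sum_add_distrib]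
  congr 1
  · congr 1
    rw [sum_range_succ']
    simp [ZZ]
  · split_ifs with h1
    · subst h1
      rw [sum_range_succ, if_neg (by omega), add_zero]
      refine sum_congr rfl fun a ha => ?_
      rw [mem_range] at ha
      rw [if_pos (by omega)]
    · refine sum_eq_zero fun a ha => ?_
      rw [if_neg (by omega)]

lemma YY_top (s : ℕ) : YY (s + 1) (s + 1) (s + 1) = ZZ s s := by
  rw [YY_rec' s _ _ le_rfl le_rfl, if_neg (by omega), if_neg (by omega)]
  simp [ZZ]

lemma ZZ_top (s : ℕ) : ZZ (s + 1) (s + 1) = ZZ (s + 1) s + ZZ s s := by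
  rw [ZZ, sum_range_succ, YY_top, ZZ]
  congr 1
  refine sum_congr rfl fun a _ => ?_
  unfold YY
  refine sum_congr rfl fun τ _ => ?_
  rw [Asc_zero (a := s + 1) (by omega), Asc_zero (a := s) (by omega)]

/-- Binomial coefficients with integer lower index. -/
def zc (n : ℕ) (k : ℤ) : ℤ := if 0 ≤ k then (n.choose k.toNat : ℤ) else 0

lemma zc_neg (n : ℕ) {k : ℤ} (h : k < 0) : zc n k = 0 := if_neg (by omega)

lemma zc_nat (n k : ℕ) : zc n k = n.choose k := by simp [zc]

lemma zc_succ (n : ℕ) (k : ℤ) : zc (n + 1) k = zc n k + zc n (k - 1) := by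
  rcases lt_or_ge k 0 with h | h
  · rw [zc_neg _ h, zc_neg _ h, zc_neg _ (by omega)]; rfl
  · obtain ⟨m, rfl⟩ := Int.eq_ofNat_of_zero_le h
    rcases m with _ | m
    · rw [zc_neg n (k := ((0 : ℕ) : ℤ) - 1) (by simp)]
      rw [zc_nat, zc_nat]; simp
    · have : ((m + 1 : ℕ) : ℤ) - 1 = (m : ℕ) := by simp
      rw [this, zc_nat, zc_nat, zc_nat, Nat.choose_succ_succ]; push_cast; ring

lemma zc_symm (n : ℕ) (k l : ℤ) (h : k + l = n) : zc n k = zc n l := by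
  rcases lt_or_ge k 0 with h1 | h1
  · rw [zc_neg _ h1]
    obtain ⟨m, rfl⟩ := Int.eq_ofNat_of_zero_le (show 0 ≤ l by omega)
    rw [zc_nat, Nat.choose_eq_zero_of_lt (by omega)]; rfl
  rcases lt_or_ge l 0 with h2 | h2
  · rw [zc_neg _ h2]
    obtain ⟨m, rfl⟩ := Int.eq_ofNat_of_zero_le h1
    rw [zc_nat, Nat.choose_eq_zero_of_lt (by omega)]; rfl
  · obtain ⟨m, rfl⟩ := Int.eq_ofNat_of_zero_le h1
    obtain ⟨p, rfl⟩ := Int.eq_ofNat_of_zero_le h2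
    rw [zc_nat, zc_nat, Nat.choose_symm_of_eq_add (show n = m + p by omega)]

lemma zc_sum (s : ℕ) (j : ℤ) (hj : 0 ≤ j) (b : ℕ) :
    ∑ a ∈ range b, zc (s + a) (a - j) = zc (s + b) (b - j - 1) := by
  induction b with
  | zero => rw [zc_neg _ (by push_cast; omega)]; simp
  | succ b ih =>
    rw [sum_range_succ, ih, ← add_assoc, zc_succ]
    push_cast
    rw [show (b : ℤ) + 1 - j - 1 = b - j by ring]
    ring

lemma MM_formula (s : ℕ) : ∀ a ≤ s, (MM s a : ℤ) = zc (s + a) a - zc (s + a) (a - 1) := by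
  induction s with
  | zero =>
    intro a ha
    obtain rfl : a = 0 := by omega
    rw [zc_neg _ (k := ((0 : ℕ) : ℤ) - 1) (by simp), zc_nat]
    have : ∀ τ : Equiv.Perm (Fin 0), N3 τ = 0 ∧ Asc 0 τ = 0 := by
      intro τ; simp [N3_eq, Asc]
    simp [MM, this]
  | succ s ih =>
    have key : ∀ a ≤ s, ((∑ v ∈ range (a + 1), MM s v : ℕ) : ℤ) =
        zc (s + 1 + a) a - zc (s + 1 + a) (a - 1) := by
      intro a ha
      push_cast
      have : ∀ v ∈ range (a + 1), (MM s v : ℤ) = zc (s + v) (v - 0) - zc (s + v) (v - 1) := by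
        intro v hv
        rw [mem_range] at hv
        rw [ih v (by omega), sub_zero]
      rw [sum_congr rfl this, sum_sub_distrib, zc_sum s 0 (by simp), zc_sum s 1 (by simp)]
      rw [show s + (a + 1) = s + 1 + a by ring]
      push_cast
      ring_nf
    intro a ha
    rcases Nat.lt_or_ge s a with h | h
    · obtain rfl : a = s + 1 := by omega
      rw [MM_top, key s le_rfl]
      have e1 := zc_succ (s + 1 + s) ((s + 1 : ℕ) : ℤ)
      have e2 := zc_succ (s + 1 + s) (((s + 1 : ℕ) : ℤ) - 1)
      have e3 := zc_symm (s + 1 + s) ((s + 1 : ℕ) : ℤ) s (by push_cast; ring)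
      rw [← add_assoc, e1, e2, e3]
      push_cast
      rw [show (s : ℤ) + 1 - 1 = s by ring]
      ring
    · rw [MM_le s a h, key a h]

lemma ZZ_formula (s : ℕ) :
    (∀ b < s, (ZZ s b : ℤ) = zc (s + b) (b - 1) - zc (s + b) (b - 4)) ∧
    (ZZ s s : ℤ) = zc (2 * s + 1) (s - 2) - zc (2 * s + 1) (s - 3) := by
  induction s with
  | zero =>
    refine ⟨by simp, ?_⟩
    rw [zc_neg _ (by simp), zc_neg _ (by simp)]
    have : ∀ τ : Equiv.Perm (Fin 0), ¬ (N3 τ + Asc 0 τ = 1 ∧ Asc 0 τ = 0) := by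
      intro τ; simp [N3_eq, Asc]
    simp only [ZZ, YY, zero_add, sum_range_one, if_neg (this _)]
    simp
  | succ s ih =>
    obtain ⟨ih1, ih2⟩ := ih
    have key : ∀ b ≤ s, ((∑ v ∈ range b, ZZ s v : ℕ) : ℤ) =
        zc (s + b) (b - 2) - zc (s + b) (b - 5) := by
      intro b hb
      push_cast
      rw [sum_congr rfl (fun v hv => ih1 v (by rw [mem_range] at hv; omega)), sum_sub_distrib,
        zc_sum s 1 (by simp), zc_sum s 4 (by simp)]
      ring_nf
    have low : ∀ b < s + 1, (ZZ (s + 1) b : ℤ) =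
        zc (s + 1 + b) (b - 1) - zc (s + 1 + b) (b - 4) := by
      intro b hb
      rw [ZZ_low s b (by omega), Nat.cast_add, Nat.cast_add, key b (by omega),
        show s + 1 + b = s + b + 1 by ring, zc_succ, zc_succ,
        show (b : ℤ) - 1 - 1 = b - 2 by ring, show (b : ℤ) - 4 - 1 = b - 5 by ring]
      rcases Nat.lt_or_ge b s with h | h
      · rw [ih1 b h, if_neg (by omega)]
        push_cast; ring
      · obtain rfl : b = s := by omega
        have hM : ((∑ a ∈ range b, MM b a : ℕ) : ℤ) = zc (b + b) (b - 1) - zc (b + b) (b - 2) := by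
          push_cast
          have : ∀ v ∈ range b, (MM b v : ℤ) = zc (b + v) (v - 0) - zc (b + v) (v - 1) := by
            intro v hv
            rw [mem_range] at hv
            rw [MM_formula b v (by omega), sub_zero]
          rw [sum_congr rfl this, sum_sub_distrib, zc_sum b 0 (by simp), zc_sum b 1 (by simp)]
          ring_nf
        rw [if_pos rfl, hM, ih2, two_mul, zc_succ, zc_succ,
          show (b : ℤ) - 2 - 1 = b - 3 by ring, show (b : ℤ) - 3 - 1 = b - 4 by ring]
        ring
    refine ⟨low, ?_⟩
    rw [ZZ_top, Nat.cast_add, low s (by omega), ih2]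
    rw [show 2 * (s + 1) + 1 = 2 * s + 1 + 1 + 1 by ring, show s + 1 + s = 2 * s + 1 by ring]
    simp only [zc_succ (2 * s + 1 + 1), zc_succ (2 * s + 1)]
    push_cast
    ring_nf

lemma answer (s : ℕ) :
    (Finset.univ.filter fun π : Equiv.Perm (Fin (s + 1)) => N3 π = 1).card = ZZ s s := by
  rw [← YY_top, card_filter, YY]
  refine sum_congr rfl fun τ _ => ?_
  rw [Asc_zero (by omega)]
  simp

theorem one_occurrence_123 (n : ℕ) (hn : 3 ≤ n) :
    (Finset.univ.filter fun π : Equiv.Perm (Fin n) => N3 π = 1).card * n =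
        3 * Nat.choose (2 * n) (n - 3) ∧
    (Finset.univ.filter fun π : Equiv.Perm (Fin n) => N3 π = 1).card *
        ((n - 3).factorial * (n + 3).factorial) = 6 * (2 * n - 1).factorial := by
  obtain ⟨m, rfl⟩ : ∃ m, n = m + 3 := ⟨n - 3, by omega⟩
  have h := (ZZ_formula (m + 2)).2
  rw [← answer (m + 2)] at h
  generalize (Finset.univ.filter fun π : Equiv.Perm (Fin (m + 2 + 1)) => N3 π = 1).card = X at h ⊢
  rw [show ((m + 2 : ℕ) : ℤ) - 2 = (m : ℕ) by push_cast; ring, zc_nat] at h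
  have hf : (X : ℤ) * (m.factorial * (m + 6).factorial) = 6 * (2 * m + 5).factorial := by
    have h1 := Nat.choose_mul_factorial_mul_factorial (show m ≤ 2 * m + 5 by omega)
    rw [show 2 * m + 5 - m = m + 5 by omega] at h1
    rw [show 2 * (m + 2) + 1 = 2 * m + 5 by ring] at h
    zify at h1
    rw [h, Nat.factorial_succ (m + 5)]
    rcases m with _ | k
    · rw [zc_neg _ (by simp)]
      simp [Nat.factorial]
    · have h2 := Nat.choose_mul_factorial_mul_factorial (show k ≤ 2 * (k + 1) + 5 by omega)
      rw [show 2 * (k + 1) + 5 - k = k + 1 + 5 + 1 by omega, Nat.factorial_succ (k + 1 + 5)] at h2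
      rw [show ((k + 1 + 2 : ℕ) : ℤ) - 3 = (k : ℕ) by push_cast; ring, zc_nat]
      zify at h2
      rw [Nat.factorial_succ k] at h1 ⊢
      push_cast at h1 h2 ⊢
      linear_combination ((k : ℤ) + 1 + 5 + 1) * h1 - ((k : ℤ) + 1) * h2
  norm_cast at hf
  have hb : X * ((m + 3 - 3).factorial * (m + 3 + 3).factorial)
      = 6 * (2 * (m + 3) - 1).factorial := by
    rw [show m + 3 - 3 = m by omega, show 2 * (m + 3) - 1 = 2 * m + 5 by omega]
    exact hf
  refine ⟨?_, hb⟩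
  have h3 := Nat.choose_mul_factorial_mul_factorial (show m ≤ 2 * m + 6 by omega)
  rw [show 2 * m + 6 - m = m + 6 by omega, Nat.factorial_succ (2 * m + 5)] at h3
  rw [show m + 3 - 3 = m by omega, show 2 * (m + 3) = 2 * m + 6 by ring]
  have hpos : 0 < m.factorial * (m + 6).factorial := by positivity
  refine Nat.eq_of_mul_eq_mul_right hpos ?_
  zify at h3 hf ⊢
  push_cast at h3 hf ⊢
  linear_combination ((m : ℤ) + 3) * hf - 3 * h3
end

section
/- The number of permutations of {1,...,n} with exactly one occurrence of the pattern [1,3,2] equals ((n−2)/(2n)) · C(2n−2, n−1). -/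
open Finset

/-- Number of occurrences of the pattern [1,3,2] in `π`:
triples a < b < c with π(a) < π(c) < π(b). -/
def N132 {n : ℕ} (π : Equiv.Perm (Fin n)) : ℕ :=
  (Finset.univ.filter fun t : Fin n × Fin n × Fin n =>
    t.1 < t.2.1 ∧ t.2.1 < t.2.2 ∧ π t.1 < π t.2.2 ∧ π t.2.2 < π t.2.1).card


/-! ### Occurrences of 132 in lists of naturals -/

/-- pairs `b` before `c` in the list with `a < c < b` -/
def n21 (a : ℕ) : List ℕ → ℕ
  | [] => 0
  | b :: l => l.countP (fun c => a < c ∧ c < b) + n21 a l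

/-- number of 132 occurrences in a list -/
def occ : List ℕ → ℕ
  | [] => 0
  | a :: l => n21 a l + occ l

/-- occurrences with `1` and `3` in `A`, and `2` in `B` -/
def ycnt : List ℕ → List ℕ → ℕ
  | [], _ => 0
  | a :: A, B => (A.map fun b => B.countP (fun c => a < c ∧ c < b)).sum + ycnt A B

/-- occurrences with `1` in `A`, and `3`, `2` in `B` -/
def xcnt (A B : List ℕ) : ℕ := (A.map fun a => n21 a B).sum

/-- non-inverted pairs across -/
def pcnt (A B : List ℕ) : ℕ := (A.map fun a => B.countP (fun c => a < c)).sum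

lemma n21_append (a : ℕ) (A B : List ℕ) :
    n21 a (A ++ B) = n21 a A + n21 a B +
      (A.map fun b => B.countP (fun c => a < c ∧ c < b)).sum := by
  induction A with
  | nil => simp [n21]
  | cons b A ih => simp only [List.cons_append, n21, List.countP_append, ih, List.map_cons,
      List.sum_cons]; omega

lemma occ_append (A B : List ℕ) :
    occ (A ++ B) = occ A + occ B + xcnt A B + ycnt A B := by
  induction A with
  | nil => simp [occ, xcnt, ycnt]
  | cons a A ih =>
    simp only [xcnt] at ih
    simp only [List.cons_append, occ, ih, n21_append, xcnt, ycnt, List.map_cons, List.sum_cons]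
    omega

lemma n21_eq_zero (a : ℕ) (B : List ℕ) :
    n21 a B = 0 ↔ B.Pairwise (fun b c => ¬ (a < c ∧ c < b)) := by
  induction B with
  | nil => simp [n21]
  | cons b B ih => simp [n21, ih, List.countP_eq_zero]

lemma n21_zero_of_le {a : ℕ} {B : List ℕ} (h : ∀ c ∈ B, c ≤ a) : n21 a B = 0 := by
  induction B with
  | nil => simp [n21]
  | cons b B ih =>
    simp only [n21, Nat.add_eq_zero_iff, List.countP_eq_zero]
    refine ⟨fun c hc => ?_, ih fun c hc => h c (List.mem_cons_of_mem _ hc)⟩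
    have := h c (List.mem_cons_of_mem _ hc)
    simp; omega

lemma ycnt_eq_zero (A B : List ℕ) :
    ycnt A B = 0 ↔ A.Pairwise (fun a b => ∀ c ∈ B, ¬ (a < c ∧ c < b)) := by
  induction A with
  | nil => simp [ycnt]
  | cons b A ih => simp [ycnt, ih, List.sum_eq_zero_iff, List.countP_eq_zero]

lemma pcnt_eq_zero (A B : List ℕ) : pcnt A B = 0 ↔ ∀ a ∈ A, ∀ c ∈ B, c ≤ a := by
  simp [pcnt, List.sum_eq_zero_iff, List.countP_eq_zero]

lemma xcnt_eq_zero_of_pcnt {A B : List ℕ} (h : pcnt A B = 0) : xcnt A B = 0 := by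
  rw [pcnt_eq_zero] at h
  simp only [xcnt, List.sum_eq_zero_iff, List.mem_map, forall_exists_index, and_imp,
    forall_apply_eq_imp_iff₂]
  exact fun a ha => n21_zero_of_le (h a ha)

lemma ycnt_eq_zero_of_pcnt {A B : List ℕ} (h : pcnt A B = 0) : ycnt A B = 0 := by
  rw [pcnt_eq_zero] at h
  rw [ycnt_eq_zero]
  rw [List.pairwise_iff_forall_sublist]
  intro a b hab c hc
  have ha : a ∈ A := hab.subset (by simp)
  have := h a ha c hc
  omega

lemma ycnt_max (A R : List ℕ) (m : ℕ) (hA : ∀ a ∈ A, a < m) : ycnt A (m :: R) = ycnt A R := by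
  induction A with
  | nil => simp [ycnt]
  | cons a A ih =>
    simp only [ycnt]
    rw [ih fun x hx => hA x (List.mem_cons_of_mem _ hx)]
    congr 2
    apply List.map_congr_left
    intro b hb
    have := hA b (List.mem_cons_of_mem _ hb)
    rw [List.countP_cons_of_neg]
    simp; omega

lemma xcnt_max (A R : List ℕ) (m : ℕ) (hR : ∀ c ∈ R, c < m) :
    xcnt A (m :: R) = xcnt A R + pcnt A R := by
  induction A with
  | nil => simp [xcnt, pcnt]
  | cons a A ih =>
    simp only [xcnt, pcnt, List.map_cons, List.sum_cons, n21] at ih ⊢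
    rw [ih]
    have : R.countP (fun c => decide (a < c ∧ c < m)) = R.countP (fun c => decide (a < c)) := by
      apply List.countP_congr
      intro c hc
      have := hR c hc
      simp [this]
    rw [this]
    omega

lemma occ_max (L R : List ℕ) (m : ℕ) (hL : ∀ a ∈ L, a < m) (hR : ∀ c ∈ R, c < m) :
    occ (L ++ m :: R) = occ L + occ R + xcnt L R + pcnt L R + ycnt L R := by
  rw [occ_append, ycnt_max _ _ _ hL, xcnt_max _ _ _ hR]
  simp only [occ]
  rw [n21_zero_of_le fun c hc => (hR c hc).le]
  omega

lemma sum_map_eq_one {l : List ℕ} {f : ℕ → ℕ} (h : (l.map f).sum = 1) :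
    ∃ l1 x l2, l = l1 ++ x :: l2 ∧ f x = 1 ∧ ∀ a ∈ l1 ++ l2, f a = 0 := by
  induction l with
  | nil => simp at h
  | cons a l ih =>
    simp only [List.map_cons, List.sum_cons] at h
    by_cases h0 : f a = 0
    · obtain ⟨l1, x, l2, rfl, h1, h2⟩ := ih (by omega)
      refine ⟨a :: l1, x, l2, by simp, h1, ?_⟩
      intro b hb
      rw [List.cons_append, List.mem_cons] at hb
      rcases hb with rfl | hb
      · exact h0
      · exact h2 b hb
    · refine ⟨[], a, l, by simp, by omega, ?_⟩
      have h3 : (l.map f).sum = 0 := by omega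
      simpa [List.sum_eq_zero_iff] using h3

lemma countP_eq_sum (l : List ℕ) (p : ℕ → Bool) :
    l.countP p = (l.map fun x => if p x then 1 else 0).sum := by
  induction l with
  | nil => simp
  | cons a l ih => rw [List.countP_cons, ih]; simp [add_comm]

lemma countP_eq_one {l : List ℕ} {p : ℕ → Bool} (h : l.countP p = 1) :
    ∃ y ∈ l, p y = true ∧ ∀ a ∈ l, a ≠ y → p a = false := by
  rw [countP_eq_sum] at h
  obtain ⟨l1, x, l2, rfl, h1, h2⟩ := sum_map_eq_one h
  refine ⟨x, by simp, by simpa using h1, ?_⟩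
  intro a ha hne
  have : a ∈ l1 ++ l2 := by
    simp at ha ⊢; tauto
  simpa using h2 a this

/-- The structure of the exactly one crossing pair case. -/
lemma cross_one {L R : List ℕ} (hd : ∀ a ∈ L, a ∉ R) (hp : pcnt L R = 1)
    (hy : ycnt L R = 0) :
    ∃ L0 x, L = L0 ++ [x] ∧ (∀ a ∈ L0, ∀ c ∈ R, c < a) ∧
      ∃ y ∈ R, x < y ∧ ∀ c ∈ R, c ≠ y → c < x := by
  obtain ⟨L0, x, L2, rfl, h1, h2⟩ := sum_map_eq_one hp
  obtain ⟨y, hyR, hxy, huniq⟩ := countP_eq_one h1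
  simp only [decide_eq_true_eq, decide_eq_false_iff_not, not_lt] at hxy huniq
  have h3 : ∀ a ∈ L0 ++ L2, ∀ c ∈ R, c < a := by
    intro a ha c hc
    have h4 := h2 a ha
    rw [List.countP_eq_zero] at h4
    have h5 := h4 c hc
    simp only [decide_eq_true_eq, not_lt] at h5
    have : a ∉ R := hd a (by simp at ha ⊢; tauto)
    have : c ≠ a := by rintro rfl; exact this hc
    omega
  have hL2 : L2 = [] := by
    rw [ycnt_eq_zero, List.pairwise_append] at hy
    have h6 := hy.2.1
    rw [List.pairwise_cons] at h6
    rcases L2 with _ | ⟨b, L2⟩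
    · rfl
    · exfalso
      exact h6.1 b (by simp) y hyR ⟨hxy, h3 b (by simp) y hyR⟩
  subst hL2
  refine ⟨L0, x, rfl, fun a ha => h3 a (by simpa using ha), y, hyR, hxy, ?_⟩
  intro c hc hne
  have h7 := huniq c hc hne
  have : x ∉ R := hd x (by simp)
  have : c ≠ x := by rintro rfl; exact this hc
  omega

lemma occ_append_min {L0 : List ℕ} {x : ℕ} : occ (L0 ++ [x]) = occ L0 + ycnt L0 [x] := by
  rw [occ_append]
  simp [occ, n21, xcnt]

lemma ycnt_min {L0 : List ℕ} {x : ℕ} (h : ∀ a ∈ L0, x < a) : ycnt L0 [x] = 0 := by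
  apply ycnt_eq_zero_of_pcnt
  rw [pcnt_eq_zero]
  intro a ha c hc
  simp at hc; subst hc
  exact (h a ha).le

lemma cross_one_conv {L0 R : List ℕ} {x y : ℕ} (hR : R.Nodup) (h1 : ∀ a ∈ L0, ∀ c ∈ R, c < a)
    (hy : y ∈ R) (hxy : x < y) (h2 : ∀ c ∈ R, c ≠ y → c < x) :
    pcnt (L0 ++ [x]) R = 1 ∧ ycnt (L0 ++ [x]) R = 0 ∧ xcnt (L0 ++ [x]) R = 0 := by
  have h0 : pcnt L0 R = 0 := by
    rw [pcnt_eq_zero]; exact fun a ha c hc => (h1 a ha c hc).le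
  have hx0 := xcnt_eq_zero_of_pcnt h0
  obtain ⟨R1, R2, rfl⟩ := List.append_of_mem hy
  have hn : y ∉ R1 ∧ y ∉ R2 := by
    rw [List.nodup_append, List.nodup_cons] at hR
    refine ⟨fun h => hR.2.2 y h y (by simp) rfl, hR.2.1.1⟩
  have h3 : ∀ c ∈ R1, c < x := fun c hc => h2 c (by simp [hc]) (by rintro rfl; exact hn.1 hc)
  have h4 : ∀ c ∈ R2, c < x := fun c hc => h2 c (by simp [hc]) (by rintro rfl; exact hn.2 hc)
  refine ⟨?_, ?_, ?_⟩
  · simp only [pcnt, List.map_append, List.sum_append] at h0 ⊢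
    rw [h0]
    have e1 : R1.countP (fun c => decide (x < c)) = 0 := by
      rw [List.countP_eq_zero]; intro c hc; have := h3 c hc; simp; omega
    have e2 : R2.countP (fun c => decide (x < c)) = 0 := by
      rw [List.countP_eq_zero]; intro c hc; have := h4 c hc; simp; omega
    simp [List.countP_append, List.countP_cons, e1, e2, hxy]
  · rw [ycnt_eq_zero, List.pairwise_append]
    refine ⟨?_, by simp, ?_⟩
    · rw [← ycnt_eq_zero]; exact ycnt_eq_zero_of_pcnt h0
    · intro a ha b hb c hc
      have := h1 a ha c hc
      omega
  · simp only [xcnt, List.map_append, List.sum_append] at hx0 ⊢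
    rw [hx0]
    simp only [List.map_cons, List.map_nil, List.sum_cons, List.sum_nil, add_zero, zero_add]
    rw [n21_append]
    rw [n21_zero_of_le fun c hc => (h3 c hc).le]
    simp only [n21]
    rw [n21_zero_of_le fun c hc => (h4 c hc).le]
    have e2 : ∀ b, R2.countP (fun c => decide (x < c ∧ c < b)) = 0 := by
      intro b
      rw [List.countP_eq_zero]; intro c hc; have := h4 c hc; simp; omega
    rw [e2]
    simp only [zero_add, List.sum_eq_zero_iff, List.mem_map, forall_exists_index, and_imp,
      forall_apply_eq_imp_iff₂]
    intro b hb
    rw [List.countP_cons, e2]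
    have := h3 b hb
    simp; omega

/-! ### Counting lists over a finite set -/

/-- arrangements of `S` with exactly `k` occurrences -/
noncomputable def W (k : ℕ) (S : Finset ℕ) : Finset (List ℕ) :=
  S.toList.permutations.toFinset.filter fun l => occ l = k

lemma mem_W {k : ℕ} {S : Finset ℕ} {l : List ℕ} :
    l ∈ W k S ↔ l.Nodup ∧ (∀ x, x ∈ l ↔ x ∈ S) ∧ occ l = k := by
  simp only [W, Finset.mem_filter, List.mem_toFinset, List.mem_permutations]
  constructor
  · rintro ⟨h, h2⟩
    refine ⟨h.nodup_iff.2 S.nodup_toList, fun x => ?_, h2⟩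
    rw [h.mem_iff, Finset.mem_toList]
  · rintro ⟨h1, h2, h3⟩
    refine ⟨?_, h3⟩
    rw [List.perm_ext_iff_of_nodup h1 S.nodup_toList]
    intro x; rw [h2, Finset.mem_toList]

lemma length_of_W {k : ℕ} {S : Finset ℕ} {l : List ℕ} (h : l ∈ W k S) : l.length = S.card := by
  rw [mem_W] at h
  rw [← List.toFinset_card_of_nodup h.1]
  congr 1
  ext x; simp [h.2.1]

/-- the `q` smallest elements -/
def low (S : Finset ℕ) (q : ℕ) : Finset ℕ := S.filter fun x => (S.filter (· < x)).card < q

lemma low_subset (S : Finset ℕ) (q : ℕ) : low S q ⊆ S := Finset.filter_subset _ _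

lemma low_lt {S : Finset ℕ} {q v u : ℕ} (hv : v ∈ low S q) (hu : u ∈ S) (hu' : u ∉ low S q) :
    v < u := by
  simp only [low, Finset.mem_filter, not_and, not_lt] at hv hu'
  by_contra hlt
  have : (S.filter (· < u)).card ≤ (S.filter (· < v)).card := by
    apply Finset.card_le_card
    intro x hx
    simp only [Finset.mem_filter] at hx ⊢
    exact ⟨hx.1, by omega⟩
  have := hu' hu
  omega

lemma low_unique {S V : Finset ℕ} (hV : V ⊆ S) (h : ∀ v ∈ V, ∀ u ∈ S, u ∉ V → v < u) :
    low S V.card = V := by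
  ext x
  simp only [low, Finset.mem_filter]
  constructor
  · rintro ⟨hx, hc⟩
    by_contra hxV
    have : V.card ≤ (S.filter (· < x)).card := by
      apply Finset.card_le_card
      intro v hv
      simp only [Finset.mem_filter]
      exact ⟨hV hv, h v hv x hx hxV⟩
    omega
  · intro hx
    refine ⟨hV hx, ?_⟩
    apply Finset.card_lt_card
    refine ⟨fun y hy => ?_, fun hsub => ?_⟩
    · simp only [Finset.mem_filter] at hy
      by_contra hyV
      have := h x hx y hy.1 hyV
      omega
    · have := hsub hx
      simp at this

lemma exists_low (S : Finset ℕ) : ∀ q ≤ S.card, ∃ V ⊆ S, V.card = q ∧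
    ∀ v ∈ V, ∀ u ∈ S, u ∉ V → v < u := by
  induction S using Finset.induction_on_max with
  | empty => intro q hq; exact ⟨∅, by simp, by simp at hq ⊢; exact hq.symm, by simp⟩
  | insert m T hm ih =>
    intro q hq
    have hmT : m ∉ T := fun h => lt_irrefl _ (hm m h)
    rw [Finset.card_insert_of_notMem hmT] at hq
    by_cases hq' : q = T.card + 1
    · refine ⟨insert m T, subset_rfl, by rw [Finset.card_insert_of_notMem hmT, hq'], ?_⟩
      intro v _ u hu hu'; exact absurd hu hu'
    · obtain ⟨V, h1, h2, h3⟩ := ih q (by omega)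
      refine ⟨V, h1.trans (Finset.subset_insert _ _), h2, ?_⟩
      intro v hv u hu hu'
      rw [Finset.mem_insert] at hu
      rcases hu with rfl | hu
      · exact hm v (h1 hv)
      · exact h3 v hv u hu hu'

lemma card_low {S : Finset ℕ} {q : ℕ} (hq : q ≤ S.card) : (low S q).card = q := by
  obtain ⟨V, h1, h2, h3⟩ := exists_low S q hq
  rw [← h2, low_unique h1 h3]

/-- second largest element -/
def snd (Q : Finset ℕ) : ℕ := (Q.erase (Q.sup id)).sup id

lemma sup_mem {Q : Finset ℕ} (h : Q.Nonempty) : Q.sup id ∈ Q := by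
  obtain ⟨x, hx, hx'⟩ := Finset.exists_mem_eq_sup Q h id
  rw [hx']; exact hx

lemma le_sup_id {Q : Finset ℕ} {x : ℕ} (h : x ∈ Q) : x ≤ Q.sup id := Finset.le_sup (f := id) h

lemma snd_spec {Q : Finset ℕ} (h : 2 ≤ Q.card) : snd Q ∈ Q ∧
    ∃ y ∈ Q, snd Q < y ∧ ∀ z ∈ Q, z ≠ y → z ≤ snd Q := by
  have hne : Q.Nonempty := Finset.card_pos.1 (by omega)
  have hy := sup_mem hne
  have hne2 : (Q.erase (Q.sup id)).Nonempty := by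
    rw [← Finset.card_pos, Finset.card_erase_of_mem hy]; omega
  have hx := sup_mem hne2
  rw [Finset.mem_erase] at hx
  refine ⟨hx.2, Q.sup id, hy, lt_of_le_of_ne (le_sup_id hx.2) hx.1, ?_⟩
  intro z hz hzy
  exact le_sup_id (Finset.mem_erase.2 ⟨hzy, hz⟩)

lemma snd_unique {Q : Finset ℕ} {x y : ℕ} (hx : x ∈ Q) (hy : y ∈ Q) (hxy : x < y)
    (h : ∀ z ∈ Q, z ≠ y → z ≤ x) : snd Q = x := by
  have h1 : Q.sup id = y := by
    apply le_antisymm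
    · apply Finset.sup_le
      intro z hz
      by_cases hzy : z = y
      · simp [hzy]
      · exact (h z hz hzy).trans hxy.le
    · exact le_sup_id hy
  rw [snd, h1]
  apply le_antisymm
  · apply Finset.sup_le
    intro z hz
    rw [Finset.mem_erase] at hz
    exact h z hz.2 hz.1
  · exact le_sup_id (Finset.mem_erase.2 ⟨hxy.ne, hx⟩)

lemma append_cons_inj {m : ℕ} {L R L' R' : List ℕ} (h : m ∉ L) (h' : m ∉ L')
    (e : L ++ m :: R = L' ++ m :: R') : L = L' ∧ R = R' := by
  induction L generalizing L' with
  | nil =>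
    cases L' with
    | nil => simpa using e
    | cons a L' => simp at e h'; exact absurd e.1 h'.1
  | cons b L ih =>
    cases L' with
    | nil => simp at e h; exact absurd e.1.symm h.1
    | cons a L' =>
      simp only [List.cons_append, List.cons.injEq] at e
      simp only [List.mem_cons, not_or] at h h'
      obtain ⟨h1, h2⟩ := ih h.2 h'.2 e.2
      exact ⟨by rw [e.1, h1], h2⟩

/-- lists assembled from pieces around `m` -/
def asm (m : ℕ) (I : Finset ℕ) (F G : ℕ → Finset (List ℕ)) : Finset (List ℕ) :=
  I.biUnion fun q => (F q ×ˢ G q).image fun p => p.1 ++ m :: p.2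

lemma mem_asm {m : ℕ} {I : Finset ℕ} {F G : ℕ → Finset (List ℕ)} {l : List ℕ} :
    l ∈ asm m I F G ↔ ∃ q ∈ I, ∃ L ∈ F q, ∃ R ∈ G q, l = L ++ m :: R := by
  simp only [asm, Finset.mem_biUnion, Finset.mem_image, Finset.mem_product, Prod.exists]
  constructor
  · rintro ⟨q, hq, L, R, ⟨hL, hR⟩, rfl⟩
    exact ⟨q, hq, L, hL, R, hR, rfl⟩
  · rintro ⟨q, hq, L, hL, R, hR, rfl⟩
    exact ⟨q, hq, L, R, ⟨hL, hR⟩, rfl⟩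

lemma card_asm {m : ℕ} {I : Finset ℕ} {F G : ℕ → Finset (List ℕ)}
    (hF : ∀ q ∈ I, ∀ L ∈ F q, m ∉ L) (hG : ∀ q ∈ I, ∀ R ∈ G q, R.length = q) :
    (asm m I F G).card = ∑ q ∈ I, (F q).card * (G q).card := by
  rw [asm, Finset.card_biUnion]
  · apply Finset.sum_congr rfl
    intro q hq
    rw [Finset.card_image_of_injOn, Finset.card_product]
    rintro ⟨L, R⟩ h ⟨L', R'⟩ h' e
    simp only [Finset.coe_product, Set.mem_prod, Finset.mem_coe] at h h'
    obtain ⟨h1, h2⟩ := append_cons_inj (hF q hq L h.1) (hF q hq L' h'.1) e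
    exact Prod.ext h1 h2
  · intro q hq q' hq' hne
    rw [Function.onFun, Finset.disjoint_left]
    intro l hl hl'
    simp only [Finset.mem_image, Finset.mem_product, Prod.exists] at hl hl'
    obtain ⟨L, R, ⟨hL, hR⟩, rfl⟩ := hl
    obtain ⟨L', R', ⟨hL', hR'⟩, e⟩ := hl'
    obtain ⟨h1, h2⟩ := append_cons_inj (hF q' hq' L' hL') (hF q hq L hL) e
    exact hne (by rw [← hG q hq R hR, ← hG q' hq' R' hR', h2])

/-- the arrangements where the left part dominates the right part -/
lemma split_zero {S : Finset ℕ} {L R : List ℕ} (hnd : (L ++ R).Nodup)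
    (hS : ∀ x, x ∈ L ++ R ↔ x ∈ S) (hp : pcnt L R = 0) :
    R.length ≤ S.card ∧ L ∈ W (occ L) (S \ low S R.length) ∧ R ∈ W (occ R) (low S R.length) := by
  rw [List.nodup_append] at hnd
  obtain ⟨h1, h2, h3⟩ := hnd
  rw [pcnt_eq_zero] at hp
  have hc : R.length = R.toFinset.card := (List.toFinset_card_of_nodup h2).symm
  have hsub : R.toFinset ⊆ S := by
    intro x hx; rw [← hS]; simp at hx ⊢; exact Or.inr hx
  have hlow : low S R.length = R.toFinset := by
    rw [hc]
    apply low_unique hsub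
    intro v hv u hu hu'
    simp only [List.mem_toFinset] at hv hu'
    have huL : u ∈ L := by
      have := (hS u).2 hu
      rw [List.mem_append] at this; tauto
    exact lt_of_le_of_ne (hp u huL v hv) (fun e => h3 u huL v hv e.symm)
  refine ⟨hc ▸ Finset.card_le_card hsub, ?_, ?_⟩
  · rw [mem_W, hlow]
    refine ⟨h1, fun x => ?_, rfl⟩
    rw [Finset.mem_sdiff, ← hS, List.mem_toFinset, List.mem_append]
    constructor
    · intro hx; exact ⟨Or.inl hx, fun h => h3 x hx x h rfl⟩
    · tauto
  · rw [mem_W, hlow]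
    exact ⟨h2, fun x => by simp, rfl⟩

lemma split_zero_conv {S : Finset ℕ} {L R : List ℕ} {q i j : ℕ}
    (hL : L ∈ W i (S \ low S q)) (hR : R ∈ W j (low S q)) :
    (L ++ R).Nodup ∧ (∀ x, x ∈ L ++ R ↔ x ∈ S) ∧ pcnt L R = 0 := by
  rw [mem_W] at hL hR
  have hlt : ∀ a ∈ L, ∀ c ∈ R, c < a := by
    intro a ha c hc
    rw [hL.2.1, Finset.mem_sdiff] at ha
    rw [hR.2.1] at hc
    exact low_lt hc ha.1 ha.2
  refine ⟨?_, ?_, ?_⟩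
  · rw [List.nodup_append]
    exact ⟨hL.1, hR.1, fun a ha b hb => (hlt a ha b hb).ne'⟩
  · intro x
    rw [List.mem_append, hL.2.1, hR.2.1, Finset.mem_sdiff]
    have := @low_subset S q x
    tauto
  · rw [pcnt_eq_zero]; exact fun a ha c hc => (hlt a ha c hc).le

lemma mem_W_insert {k m : ℕ} {S : Finset ℕ} (hm : m ∉ S) {l : List ℕ} :
    l ∈ W k (insert m S) ↔ ∃ L R, l = L ++ m :: R ∧ (L ++ R).Nodup ∧
      (∀ x, x ∈ L ++ R ↔ x ∈ S) ∧ occ l = k := by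
  rw [mem_W]
  constructor
  · rintro ⟨h1, h2, h3⟩
    obtain ⟨L, R, rfl⟩ := List.append_of_mem ((h2 m).2 (Finset.mem_insert_self _ _))
    have h4 := List.nodup_middle.1 h1
    rw [List.nodup_cons] at h4
    refine ⟨L, R, rfl, h4.2, fun x => ?_, h3⟩
    have h5 := h2 x
    by_cases hx : x = m
    · subst hx; tauto
    · rw [Finset.mem_insert] at h5
      rw [List.mem_append, List.mem_cons] at h5
      rw [List.mem_append]
      tauto
  · rintro ⟨L, R, rfl, h1, h2, h3⟩
    refine ⟨?_, ?_, h3⟩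
    · rw [List.nodup_middle, List.nodup_cons]
      exact ⟨fun h => hm ((h2 m).1 h), h1⟩
    · intro x
      have h5 := h2 x
      rw [List.mem_append] at h5
      rw [Finset.mem_insert, List.mem_append, List.mem_cons]
      tauto

lemma notMem_of_W {k m : ℕ} {S T : Finset ℕ} (hm : ∀ x ∈ S, x < m) (hT : T ⊆ S) {L : List ℕ}
    (hL : L ∈ W k T) : m ∉ L := by
  rw [mem_W] at hL
  intro h
  exact lt_irrefl _ (hm m (hT ((hL.2.1 m).1 h)))

lemma asm_zero_card {m i j : ℕ} {S : Finset ℕ} (hm : ∀ x ∈ S, x < m) :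
    (asm m (range (S.card + 1)) (fun q => W i (S \ low S q)) (fun q => W j (low S q))).card =
      ∑ q ∈ range (S.card + 1), (W i (S \ low S q)).card * (W j (low S q)).card := by
  apply card_asm
  · intro q _ L hL
    exact notMem_of_W hm Finset.sdiff_subset hL
  · intro q hq R hR
    rw [length_of_W hR, card_low]
    rw [Finset.mem_range] at hq; omega

lemma occ_split {m : ℕ} {S : Finset ℕ} (hm : ∀ x ∈ S, x < m) {L R : List ℕ}
    (hS : ∀ x, x ∈ L ++ R ↔ x ∈ S) :
    occ (L ++ m :: R) = occ L + occ R + xcnt L R + pcnt L R + ycnt L R :=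
  occ_max L R m (fun a ha => hm a ((hS a).1 (by simp [ha])))
    (fun a ha => hm a ((hS a).1 (by simp [ha])))

lemma asm_zero_sub {m i j : ℕ} {S : Finset ℕ} (hm : ∀ x ∈ S, x < m) {l : List ℕ}
    (hl : l ∈ asm m (range (S.card + 1)) (fun q => W i (S \ low S q)) (fun q => W j (low S q))) :
    l ∈ W (i + j) (insert m S) := by
  rw [mem_asm] at hl
  obtain ⟨q, hq, L, hL, R, hR, rfl⟩ := hl
  obtain ⟨h1, h2, h3⟩ := split_zero_conv hL hR
  rw [mem_W_insert (fun h => lt_irrefl _ (hm m h))]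
  refine ⟨L, R, rfl, h1, h2, ?_⟩
  rw [occ_split hm h2, h3, xcnt_eq_zero_of_pcnt h3, ycnt_eq_zero_of_pcnt h3]
  rw [mem_W] at hL hR
  omega

lemma mem_asm_zero {m : ℕ} {S : Finset ℕ} {L R : List ℕ} (hnd : (L ++ R).Nodup)
    (hS : ∀ x, x ∈ L ++ R ↔ x ∈ S) (hp : pcnt L R = 0) :
    L ++ m :: R ∈ asm m (range (S.card + 1)) (fun q => W (occ L) (S \ low S q))
      (fun q => W (occ R) (low S q)) := by
  obtain ⟨h1, h2, h3⟩ := split_zero hnd hS hp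
  rw [mem_asm]
  exact ⟨R.length, Finset.mem_range.2 (by omega), L, h2, R, h3, rfl⟩

theorem recA {m : ℕ} {S : Finset ℕ} (hm : ∀ x ∈ S, x < m) :
    (W 0 (insert m S)).card =
      ∑ q ∈ range (S.card + 1), (W 0 (S \ low S q)).card * (W 0 (low S q)).card := by
  rw [← asm_zero_card hm]
  congr 1
  ext l
  constructor
  · intro hl
    rw [mem_W_insert (fun h => lt_irrefl _ (hm m h))] at hl
    obtain ⟨L, R, rfl, h1, h2, h3⟩ := hl
    rw [occ_split hm h2] at h3
    have := mem_asm_zero (m := m) h1 h2 (by omega)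
    rwa [show occ L = 0 by omega, show occ R = 0 by omega] at this
  · exact fun hl => asm_zero_sub hm hl

/-- the arrangements where the maximum takes part in the occurrence -/
noncomputable def T3 (m : ℕ) (S : Finset ℕ) : Finset (List ℕ) :=
  asm m (Finset.Ico 1 S.card)
    (fun r => (W 0 (S \ low S (r + 1))).image fun L => L ++ [snd (low S (r + 1))])
    (fun r => W 0 ((low S (r + 1)).erase (snd (low S (r + 1)))))

lemma T3_card {m : ℕ} {S : Finset ℕ} (hm : ∀ x ∈ S, x < m) :
    (T3 m S).card = ∑ r ∈ Finset.Ico 1 S.card, (W 0 (S \ low S (r + 1))).card *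
      (W 0 ((low S (r + 1)).erase (snd (low S (r + 1))))).card := by
  rw [T3, card_asm]
  · apply Finset.sum_congr rfl
    intro r _
    rw [Finset.card_image_of_injective]
    intro a b h
    simpa using h
  · intro r hr L hL
    rw [Finset.mem_Ico] at hr
    rw [Finset.mem_image] at hL
    obtain ⟨L0, hL0, rfl⟩ := hL
    have h1 := notMem_of_W hm Finset.sdiff_subset hL0
    have h2 := (snd_spec (Q := low S (r + 1)) (by rw [card_low (by omega)]; omega)).1
    have h3 := hm _ (low_subset _ _ h2)
    simp [h1]; omega
  · intro r hr R hR
    rw [Finset.mem_Ico] at hr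
    have h2 := (snd_spec (Q := low S (r + 1)) (by rw [card_low (by omega)]; omega)).1
    rw [length_of_W hR, Finset.card_erase_of_mem h2, card_low (by omega)]
    omega

lemma mem_T3 {m : ℕ} {S : Finset ℕ} {l : List ℕ} (hl : l ∈ T3 m S) :
    ∃ L R, l = L ++ m :: R ∧ (L ++ R).Nodup ∧ (∀ x, x ∈ L ++ R ↔ x ∈ S) ∧
      occ L = 0 ∧ occ R = 0 ∧ pcnt L R = 1 ∧ ycnt L R = 0 ∧ xcnt L R = 0 := by
  rw [T3, mem_asm] at hl
  obtain ⟨r, hr, L, hL, R, hR, rfl⟩ := hl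
  rw [Finset.mem_Ico] at hr
  rw [Finset.mem_image] at hL
  obtain ⟨L0, hL0, rfl⟩ := hL
  obtain ⟨hx, y, hy, hxy, h2⟩ :=
    (snd_spec (Q := low S (r + 1)) (by rw [card_low (by omega)]; omega))
  set Q := low S (r + 1) with hQ
  set x := snd Q
  rw [mem_W] at hL0 hR
  have hlt : ∀ a ∈ L0, ∀ c ∈ Q, c < a := by
    intro a ha c hc
    rw [hL0.2.1, Finset.mem_sdiff] at ha
    exact low_lt hc ha.1 ha.2
  have hRQ : ∀ c ∈ R, c ∈ Q ∧ c ≠ x := by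
    intro c hc
    rw [hR.2.1, Finset.mem_erase] at hc
    exact hc.symm
  obtain ⟨k1, k2, k3⟩ := cross_one_conv (x := x) (y := y) hR.1
    (fun a ha c hc => hlt a ha c (hRQ c hc).1)
    ((hR.2.1 y).2 (Finset.mem_erase.2 ⟨hxy.ne', hy⟩)) hxy
    (fun c hc hne => lt_of_le_of_ne (h2 c (hRQ c hc).1 hne) (hRQ c hc).2)
  refine ⟨L0 ++ [x], R, rfl, ?_, ?_, ?_, hR.2.2, k1, k2, k3⟩
  · rw [List.nodup_append, List.nodup_append]
    refine ⟨⟨hL0.1, by simp, ?_⟩, hR.1, ?_⟩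
    · intro a ha b hb
      simp at hb; subst hb
      exact (hlt a ha x hx).ne'
    · intro a ha b hb
      rw [List.mem_append, List.mem_singleton] at ha
      rcases ha with ha | rfl
      · exact (hlt a ha b (hRQ b hb).1).ne'
      · exact (hRQ b hb).2.symm
  · intro z
    simp only [List.mem_append, List.mem_singleton, hL0.2.1, hR.2.1, Finset.mem_sdiff,
      Finset.mem_erase]
    have := @low_subset S (r + 1) z
    rw [← hQ] at this
    by_cases hz : z = x
    · subst hz; simp [hx, this hx]
    · tauto
  · rw [occ_append_min, hL0.2.2, ycnt_min fun a ha => hlt a ha x hx]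

lemma mem_T3_conv {m : ℕ} {S : Finset ℕ} {L R : List ℕ} (hnd : (L ++ R).Nodup)
    (hS : ∀ x, x ∈ L ++ R ↔ x ∈ S) (hL : occ L = 0) (hR : occ R = 0) (hp : pcnt L R = 1)
    (hy : ycnt L R = 0) : L ++ m :: R ∈ T3 m S := by
  rw [List.nodup_append] at hnd
  obtain ⟨n1, n2, n3⟩ := hnd
  obtain ⟨L0, x, rfl, h1, y, hyR, hxy, h2⟩ :=
    cross_one (fun a ha h => n3 a ha a h rfl) hp hy
  have hxR : x ∉ R := fun h => n3 x (by simp) x h rfl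
  have hc : (insert x R.toFinset).card = R.length + 1 := by
    rw [Finset.card_insert_of_notMem (by simpa using hxR), List.toFinset_card_of_nodup n2]
  have hsub : insert x R.toFinset ⊆ S := by
    intro z hz
    rw [← hS]
    simp only [Finset.mem_insert, List.mem_toFinset] at hz
    simp only [List.mem_append, List.mem_singleton]
    tauto
  have hL0 : ∀ a ∈ L0, ∀ c ∈ insert x R.toFinset, c < a := by
    intro a ha c hc
    simp only [Finset.mem_insert, List.mem_toFinset] at hc
    rcases hc with rfl | hc
    · exact hxy.trans (h1 a ha y hyR)
    · exact h1 a ha c hc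
  have hlow : low S (R.length + 1) = insert x R.toFinset := by
    rw [← hc]
    apply low_unique hsub
    intro v hv u hu hu'
    apply hL0 u _ v hv
    rw [← hS] at hu
    simp only [Finset.mem_insert, List.mem_toFinset] at hu'
    simp only [List.mem_append, List.mem_singleton] at hu
    tauto
  have hsnd : snd (insert x R.toFinset) = x := by
    apply snd_unique (y := y) (by simp) (by simp [hyR]) hxy
    intro z hz hne
    simp only [Finset.mem_insert, List.mem_toFinset] at hz
    rcases hz with rfl | hz
    · exact le_rfl
    · exact (h2 z hz hne).le
  rw [T3, mem_asm]
  refine ⟨R.length, ?_, L0 ++ [x], ?_, R, ?_, rfl⟩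
  · rw [Finset.mem_Ico]
    have := Finset.card_le_card hsub
    have := List.length_pos_of_mem hyR
    omega
  · rw [Finset.mem_image, hlow, hsnd]
    refine ⟨L0, ?_, rfl⟩
    rw [mem_W]
    rw [List.nodup_append] at n1
    refine ⟨n1.1, ?_, ?_⟩
    · intro z
      rw [Finset.mem_sdiff, ← hS]
      simp only [Finset.mem_insert, List.mem_toFinset, List.mem_append, List.mem_singleton]
      constructor
      · intro hz
        refine ⟨Or.inl (Or.inl hz), ?_⟩
        intro h
        have := hL0 z hz z (by simpa using h)
        omega
      · tauto
    · rw [occ_append_min] at hL; omega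
  · rw [hlow, hsnd, mem_W]
    refine ⟨n2, ?_, hR⟩
    intro z
    rw [Finset.erase_insert (by simpa using hxR), List.mem_toFinset]

theorem recB {m : ℕ} {S : Finset ℕ} (hm : ∀ x ∈ S, x < m) :
    (W 1 (insert m S)).card =
      ∑ q ∈ range (S.card + 1), (W 1 (S \ low S q)).card * (W 0 (low S q)).card +
      ∑ q ∈ range (S.card + 1), (W 0 (S \ low S q)).card * (W 1 (low S q)).card +
      ∑ r ∈ Finset.Ico 1 S.card, (W 0 (S \ low S (r + 1))).card *
        (W 0 ((low S (r + 1)).erase (snd (low S (r + 1))))).card := by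
  have hmS : m ∉ S := fun h => lt_irrefl _ (hm m h)
  rw [← asm_zero_card hm, ← asm_zero_card hm, ← T3_card hm]
  rw [← Finset.card_union_of_disjoint, ← Finset.card_union_of_disjoint]
  · congr 1
    ext l
    simp only [Finset.mem_union]
    constructor
    · intro hl
      rw [mem_W_insert hmS] at hl
      obtain ⟨L, R, rfl, h1, h2, h3⟩ := hl
      rw [occ_split hm h2] at h3
      by_cases hp : pcnt L R = 0
      · left
        have hx := xcnt_eq_zero_of_pcnt hp
        have hy := ycnt_eq_zero_of_pcnt hp
        have h4 := mem_asm_zero (m := m) h1 h2 hp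
        by_cases h0 : occ L = 0
        · right
          rwa [h0, show occ R = 1 by omega] at h4
        · left
          rwa [show occ L = 1 by omega, show occ R = 0 by omega] at h4
      · right
        exact mem_T3_conv h1 h2 (by omega) (by omega) (by omega) (by omega)
    · rintro ((hl | hl) | hl)
      · exact asm_zero_sub hm hl
      · exact asm_zero_sub hm hl
      · obtain ⟨L, R, rfl, h1, h2, h3, h4, h5, h6, h7⟩ := mem_T3 hl
        rw [mem_W_insert hmS]
        refine ⟨L, R, rfl, h1, h2, ?_⟩
        rw [occ_split hm h2]; omega
  · rw [Finset.disjoint_left]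
    intro l hl hl'
    obtain ⟨L, R, rfl, h1, h2, h3, h4, h5, h6, h7⟩ := mem_T3 hl'
    have hmL : m ∉ L := fun h => hmS ((h2 m).1 (by simp [h]))
    rw [Finset.mem_union, mem_asm, mem_asm] at hl
    rcases hl with ⟨q, hq, L', hL, R', hR, e⟩ | ⟨q, hq, L', hL, R', hR, e⟩
    all_goals
      obtain ⟨rfl, rfl⟩ := append_cons_inj hmL (notMem_of_W hm Finset.sdiff_subset hL) e
      rw [mem_W] at hL hR
      omega
  · rw [Finset.disjoint_left]
    intro l hl hl'
    rw [mem_asm] at hl hl'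
    obtain ⟨q, hq, L, hL, R, hR, rfl⟩ := hl
    obtain ⟨q', hq', L', hL', R', hR', e⟩ := hl'
    obtain ⟨rfl, rfl⟩ := append_cons_inj (notMem_of_W hm Finset.sdiff_subset hL)
      (notMem_of_W hm Finset.sdiff_subset hL') e
    rw [mem_W] at hL hL'
    omega

lemma card_high {S : Finset ℕ} {q : ℕ} (hq : q ≤ S.card) : (S \ low S q).card = S.card - q := by
  rw [Finset.card_sdiff_of_subset (low_subset S q), card_low hq]

lemma W_empty_zero : (W 0 ∅).card = 1 := by
  rw [Finset.card_eq_one]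
  refine ⟨[], ?_⟩
  ext l
  rw [mem_W, Finset.mem_singleton]
  constructor
  · rintro ⟨_, h, _⟩
    rw [List.eq_nil_iff_forall_not_mem]
    intro x hx
    simpa using (h x).1 hx
  · rintro rfl
    simp [occ]

lemma W_empty_one : (W 1 ∅).card = 0 := by
  rw [Finset.card_eq_zero, Finset.eq_empty_iff_forall_notMem]
  intro l hl
  rw [mem_W] at hl
  obtain ⟨_, h, h'⟩ := hl
  have : l = [] := by
    rw [List.eq_nil_iff_forall_not_mem]
    intro x hx
    simpa using (h x).1 hx
  subst this
  simp [occ] at h'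

lemma exists_max {S : Finset ℕ} {n : ℕ} (h : S.card = n + 1) :
    ∃ m T, S = insert m T ∧ (∀ x ∈ T, x < m) ∧ T.card = n := by
  have hne : S.Nonempty := Finset.card_pos.1 (by omega)
  refine ⟨S.sup id, S.erase (S.sup id), ?_, ?_, ?_⟩
  · rw [Finset.insert_erase (sup_mem hne)]
  · intro x hx
    rw [Finset.mem_erase] at hx
    exact lt_of_le_of_ne (le_sup_id hx.2) hx.1
  · rw [Finset.card_erase_of_mem (sup_mem hne)]; omega

lemma catalan_succ_range (n : ℕ) :
    catalan (n + 1) = ∑ q ∈ range (n + 1), catalan (n - q) * catalan q := by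
  rw [catalan_succ, Finset.sum_range]
  exact Finset.sum_congr rfl fun i _ => mul_comm _ _

theorem card_W_zero (n : ℕ) : ∀ S : Finset ℕ, S.card = n → (W 0 S).card = catalan n := by
  induction n using Nat.strong_induction_on with
  | _ n ih =>
    intro S hS
    rcases n with _ | n
    · rw [Finset.card_eq_zero] at hS
      rw [hS, W_empty_zero, catalan_zero]
    · obtain ⟨m, T, rfl, hm, hT⟩ := exists_max hS
      rw [recA hm, catalan_succ_range, hT]
      apply Finset.sum_congr rfl
      intro q hq
      rw [Finset.mem_range] at hq
      rw [ih (n - q) (by omega) _ (by rw [card_high (by omega), hT]),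
        ih q (by omega) _ (card_low (by omega))]

/-- half of `D n - 3 D (n-1)` -/
def bet (n : ℕ) : ℚ :=
  if n < 2 then 0 else ((n.centralBinom : ℚ) - 3 * ((n - 1).centralBinom : ℚ)) / 2

lemma central_conv (n : ℕ) : ((n + 1).centralBinom : ℚ) =
    2 * ∑ q ∈ range (n + 1), ((n - q).centralBinom : ℚ) * (catalan q : ℚ) := by
  have e1 : ∀ k : ℕ, (k.centralBinom : ℚ) = (k + 1) * (catalan k : ℚ) := by
    intro k
    rw [← succ_mul_catalan_eq_centralBinom]; push_cast; ring
  have e2 : ∑ q ∈ range (n + 1), ((n - q).centralBinom : ℚ) * (catalan q : ℚ) =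
      ∑ q ∈ range (n + 1), (q.centralBinom : ℚ) * (catalan (n - q) : ℚ) := by
    rw [← Finset.sum_range_reflect]
    apply Finset.sum_congr rfl
    intro q hq
    rw [Finset.mem_range] at hq
    rw [show n + 1 - 1 - q = n - q by omega, show n - (n - q) = q by omega]
  rw [two_mul]
  nth_rewrite 2 [e2]
  rw [← Finset.sum_add_distrib, e1, catalan_succ_range]
  push_cast
  rw [Finset.mul_sum]
  apply Finset.sum_congr rfl
  intro q hq
  rw [Finset.mem_range] at hq
  rw [e1, e1, Nat.cast_sub (by omega)]
  ring

lemma bet_rec (N : ℕ) : bet (N + 1) =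
    ∑ q ∈ range (N + 1), bet (N - q) * (catalan q : ℚ) +
    ∑ q ∈ range (N + 1), (catalan (N - q) : ℚ) * bet q +
    ∑ r ∈ Finset.Ico 1 N, (catalan (N - (r + 1)) : ℚ) * (catalan r : ℚ) := by
  have e2 : ∑ q ∈ range (N + 1), (catalan (N - q) : ℚ) * bet q =
      ∑ q ∈ range (N + 1), bet (N - q) * (catalan q : ℚ) := by
    rw [← Finset.sum_range_reflect]
    apply Finset.sum_congr rfl
    intro q hq
    rw [Finset.mem_range] at hq
    rw [show N + 1 - 1 - q = N - q by omega, show N - (N - q) = q by omega, mul_comm]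
  rw [e2]
  rcases N with _ | M
  · simp [bet]
  have e3 : ∑ r ∈ Finset.Ico 1 (M + 1), (catalan (M + 1 - (r + 1)) : ℚ) * (catalan r : ℚ) =
      catalan (M + 1) - catalan M := by
    have c := catalan_succ_range M
    rw [Finset.range_eq_Ico, Finset.sum_eq_sum_Ico_succ_bot (Nat.succ_pos M)] at c
    rw [c]
    push_cast
    simp
  have e4 : ∑ q ∈ range (M + 1 + 1), bet (M + 1 - q) * (catalan q : ℚ) =
      ∑ q ∈ range M, (((M + 1 - q).centralBinom : ℚ) - 3 * ((M - q).centralBinom : ℚ)) / 2 *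
        (catalan q : ℚ) := by
    rw [Finset.sum_range_succ, Finset.sum_range_succ]
    have z1 : bet (M + 1 - M) = 0 := by simp [bet]
    have z2 : bet (M + 1 - (M + 1)) = 0 := by simp [bet]
    rw [z1, z2]
    simp only [zero_mul, add_zero]
    apply Finset.sum_congr rfl
    intro q hq
    rw [Finset.mem_range] at hq
    rw [bet, if_neg (by omega), show M + 1 - q - 1 = M - q by omega]
  have e5 : ∑ q ∈ range M, (((M + 1 - q).centralBinom : ℚ) - 3 * ((M - q).centralBinom : ℚ)) / 2 *
        (catalan q : ℚ) =
      (∑ q ∈ range M, ((M + 1 - q).centralBinom : ℚ) * (catalan q : ℚ)) / 2 -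
      3 * (∑ q ∈ range M, ((M - q).centralBinom : ℚ) * (catalan q : ℚ)) / 2 := by
    rw [Finset.sum_div, Finset.mul_sum, Finset.sum_div, ← Finset.sum_sub_distrib]
    exact Finset.sum_congr rfl fun q _ => by ring
  have c1 := central_conv (M + 1)
  have c2 := central_conv M
  rw [Finset.sum_range_succ, Finset.sum_range_succ] at c1
  rw [Finset.sum_range_succ] at c2
  have d0 : Nat.centralBinom 0 = 1 := Nat.centralBinom_zero
  have d1 : Nat.centralBinom 1 = 2 := by decide
  rw [show M + 1 - M = 1 by omega, show M + 1 - (M + 1) = 0 by omega, d0, d1] at c1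
  rw [show M - M = 0 by omega, d0] at c2
  rw [e3, e4, e5, bet, if_neg (by omega), show M + 1 + 1 - 1 = M + 1 by omega]
  push_cast at c1 c2 ⊢
  linarith

theorem card_W_one (n : ℕ) : ∀ S : Finset ℕ, S.card = n → ((W 1 S).card : ℚ) = bet n := by
  induction n using Nat.strong_induction_on with
  | _ n ih =>
    intro S hS
    rcases n with _ | n
    · rw [Finset.card_eq_zero] at hS
      rw [hS, W_empty_one]; simp [bet]
    · obtain ⟨m, T, rfl, hm, hT⟩ := exists_max hS
      rw [recB hm, bet_rec, hT]
      push_cast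
      congr 1
      · congr 1
        all_goals
          apply Finset.sum_congr rfl
          intro q hq
          rw [Finset.mem_range] at hq
        · rw [ih (n - q) (by omega) _ (by rw [card_high (by omega), hT]),
            card_W_zero q _ (card_low (by omega))]
        · rw [card_W_zero (n - q) _ (by rw [card_high (by omega), hT]),
            ih q (by omega) _ (card_low (by omega))]
      · apply Finset.sum_congr rfl
        intro r hr
        rw [Finset.mem_Ico] at hr
        have hc : (low T (r + 1)).card = r + 1 := card_low (by omega)
        rw [card_W_zero (n - (r + 1)) _ (by rw [card_high (by omega), hT]),
          card_W_zero r _ (by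
            rw [Finset.card_erase_of_mem (snd_spec (by omega)).1, hc]; omega)]

/-! ### From lists back to permutations -/

lemma countP_ofFn {n : ℕ} (f : Fin n → ℕ) (p : ℕ → Bool) :
    (List.ofFn f).countP p = ∑ i, if p (f i) then 1 else 0 := by
  rw [countP_eq_sum, List.map_ofFn, List.sum_ofFn]
  rfl

lemma n21_ofFn {n : ℕ} (x : ℕ) (f : Fin n → ℕ) :
    n21 x (List.ofFn f) = ∑ b, ∑ c, if b < c ∧ x < f c ∧ f c < f b then 1 else 0 := by
  induction n with
  | zero => simp [n21]
  | succ n ih =>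
    rw [List.ofFn_succ, n21, ih, countP_ofFn, Fin.sum_univ_succ]
    simp [Fin.sum_univ_succ, -Finset.sum_boole]

lemma occ_ofFn {n : ℕ} (f : Fin n → ℕ) :
    occ (List.ofFn f) =
      ∑ a, ∑ b, ∑ c, if a < b ∧ b < c ∧ f a < f c ∧ f c < f b then 1 else 0 := by
  induction n with
  | zero => simp [occ]
  | succ n ih =>
    rw [List.ofFn_succ, occ, ih, n21_ofFn, Fin.sum_univ_succ]
    simp [Fin.sum_univ_succ, -Finset.sum_boole]

lemma N132_eq_occ {n : ℕ} (π : Equiv.Perm (Fin n)) :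
    N132 π = occ (List.ofFn fun i => (π i : ℕ)) := by
  rw [occ_ofFn, N132, Finset.card_filter, Fintype.sum_prod_type]
  apply Finset.sum_congr rfl
  intro a _
  rw [Fintype.sum_prod_type]
  rfl

lemma card_perm_eq (n : ℕ) :
    (Finset.univ.filter fun π : Equiv.Perm (Fin n) => N132 π = 1).card =
      (W 1 (range n)).card := by
  apply Finset.card_bij (fun π _ => List.ofFn fun i => (π i : ℕ))
  · intro π hπ
    rw [Finset.mem_filter, N132_eq_occ] at hπ
    rw [mem_W]
    refine ⟨?_, ?_, hπ.2⟩
    · rw [List.nodup_ofFn]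
      intro a b h
      exact π.injective (Fin.ext h)
    · intro x
      rw [List.mem_ofFn, Finset.mem_range]
      constructor
      · rintro ⟨i, rfl⟩
        exact (π i).2
      · intro hx
        exact ⟨π.symm ⟨x, hx⟩, by simp⟩
  · intro π _ σ _ h
    have := List.ofFn_injective h
    ext i
    exact congrFun this i
  · intro l hl
    have hlen := length_of_W hl
    rw [Finset.card_range] at hlen
    rw [mem_W] at hl
    obtain ⟨h1, h2, h3⟩ := hl
    have hlt : ∀ i : Fin n, l.get (i.cast hlen.symm) < n := by
      intro i
      rw [← Finset.mem_range, ← h2]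
      exact List.get_mem _ _
    let g : Fin n → Fin n := fun i => ⟨l.get (i.cast hlen.symm), hlt i⟩
    have hg : Function.Injective g := by
      intro a b h
      have h4 : l.get (a.cast hlen.symm) = l.get (b.cast hlen.symm) := congrArg Fin.val h
      have h5 := List.nodup_iff_injective_get.1 h1 h4
      exact Fin.cast_injective _ h5
    have e : (List.ofFn fun i => (g i : ℕ)) = l := by
      subst hlen
      exact List.ofFn_get l
    refine ⟨Equiv.ofBijective g (Finite.injective_iff_bijective.1 hg), ?_, e⟩
    rw [Finset.mem_filter, N132_eq_occ]
    refine ⟨Finset.mem_univ _, ?_⟩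
    rw [← h3]
    exact congrArg occ e

theorem one_occurrence_132 (n : ℕ) (hn : 1 ≤ n) :
    (Finset.univ.filter fun π : Equiv.Perm (Fin n) => N132 π = 1).card * (2 * n) =
      (n - 2) * Nat.choose (2 * n - 2) (n - 1) := by
  rw [card_perm_eq]
  have h := card_W_one n (range n) (Finset.card_range n)
  by_cases h2 : n < 2
  · rw [bet, if_pos h2] at h
    have h0 : (W 1 (range n)).card = 0 := by exact_mod_cast h
    rw [h0, show n - 2 = 0 by omega]; simp
  · obtain ⟨k, rfl⟩ : ∃ k, n = k + 2 := ⟨n - 2, by omega⟩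
    rw [bet, if_neg h2, show k + 2 - 1 = k + 1 by omega] at h
    have hs := Nat.succ_mul_centralBinom_succ (k + 1)
    have hs' : ((k : ℚ) + 2) * ((k + 2).centralBinom : ℚ) =
        2 * (2 * (k + 1) + 1) * ((k + 1).centralBinom : ℚ) := by
      have : (((k + 1 + 1) * (k + 1 + 1).centralBinom : ℕ) : ℚ) =
        ((2 * (2 * (k + 1) + 1) * (k + 1).centralBinom : ℕ) : ℚ) := by rw [hs]
      push_cast at this
      linarith
    rw [show 2 * (k + 2) - 2 = 2 * (k + 1) by omega, show k + 2 - 1 = k + 1 by omega,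
      show k + 2 - 2 = k by omega]
    rw [← Nat.centralBinom_eq_two_mul_choose]
    have : ((W 1 (range (k + 2))).card : ℚ) * (2 * (k + 2)) = k * ((k + 1).centralBinom : ℚ) := by
      rw [h]; linarith
    exact_mod_cast this
end
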